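/- Assume condition (G) for some γ ∈ ℕ, d > 0 and L > 0. Let 0 ≤ k < L with [k]+1 ≤ γ and let ℓ ∈ [0,k]. Then there exists a constant C₂ such that for every φ ∈ L¹_k satisfying ∫_{ℝ^N} x^α φ(x) dx = 0 for all multi-indices α with |α| ≤ k, one has ∫_{ℝ^N} |x|^ℓ |(e^{tℒ}φ)(x)| dx ≤ C₂ t^{−(k−ℓ)/d} ∫_{ℝ^N} |x|^k |φ(x)| dx for all t > 0. -/

import Mathlib

open MeasureTheory Filter Asymptotics Topology
open scoped ENNReal BigOperators

noncomputable section

/-- Partial derivative in the `i`-th coordinate direction. -/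
def pderivE (N : ℕ) (i : Fin N) (f : EuclideanSpace ℝ (Fin N) → ℝ) :
    EuclideanSpace ℝ (Fin N) → ℝ :=
  fun x => fderiv ℝ f x (EuclideanSpace.single i 1)

/-- Multi-index partial derivative `∂_x^α`. -/
def mderivE (N : ℕ) (α : Fin N → ℕ) (f : EuclideanSpace ℝ (Fin N) → ℝ) :
    EuclideanSpace ℝ (Fin N) → ℝ :=
  (List.ofFn fun i : Fin N => (pderivE N i)^[α i]).foldr (fun T h => T h) f

/-- `x ^ α` for a multi-index `α`. -/
def mpowE (N : ℕ) (α : Fin N → ℕ) (x : EuclideanSpace ℝ (Fin N)) : ℝ :=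
  ∏ i, x i ^ α i

/-- `α !` for a multi-index `α`. -/
def mfactE (N : ℕ) (α : Fin N → ℕ) : ℕ := ∏ i, Nat.factorial (α i)

/-- `g_α(x,t) := ((-1)^{|α|}/α!) ∂_x^α G(x, t+1)`. -/
def gA (N : ℕ) (G : EuclideanSpace ℝ (Fin N) → ℝ → ℝ) (α : Fin N → ℕ)
    (x : EuclideanSpace ℝ (Fin N)) (t : ℝ) : ℝ :=
  ((-1 : ℝ) ^ (∑ i, α i) / (mfactE N α : ℝ)) * mderivE N α (fun y => G y (t + 1)) x

/-- Condition (G) for the kernel `G` with parameters `γ`, `d`, `L`. -/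
structure CondG (N : ℕ) (G : EuclideanSpace ℝ (Fin N) → ℝ → ℝ) (γ : ℕ) (d L : ℝ) : Prop where
  smooth : ContDiffOn ℝ γ (fun p : EuclideanSpace ℝ (Fin N) × ℝ => G p.1 p.2) {p | 0 < p.2}
  scaling : ∀ x : EuclideanSpace ℝ (Fin N), ∀ t : ℝ, 0 < t →
      G x t = t ^ (-(N : ℝ) / d) * G ((t ^ (-(1 : ℝ) / d)) • x) 1
  decay : ∀ j : ℕ, j ≤ γ → ∃ C : ℝ, ∀ x : EuclideanSpace ℝ (Fin N),
      (1 + ‖x‖) ^ ((N : ℝ) + L + j) * ‖iteratedFDeriv ℝ j (fun y => G y 1) x‖ ≤ C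
  semigroup : ∀ x : EuclideanSpace ℝ (Fin N), ∀ t s : ℝ, 0 < s → s < t →
      G x t = ∫ y, G (x - y) (t - s) * G y s

/-- `(e^{tℒ}φ)(x) = ∫ G(x-y,t) φ(y) dy`. -/
def sgOp (N : ℕ) (G : EuclideanSpace ℝ (Fin N) → ℝ → ℝ) (t : ℝ)
    (φ : EuclideanSpace ℝ (Fin N) → ℝ) : EuclideanSpace ℝ (Fin N) → ℝ :=
  fun x => ∫ y, G (x - y) t * φ y

/-- `∫ x^α f(x) dx`. -/
def momE (N : ℕ) (α : Fin N → ℕ) (f : EuclideanSpace ℝ (Fin N) → ℝ) : ℝ :=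
  ∫ x, mpowE N α x * f x

/-- Auxiliary fuelled recursion computing the coefficients `M_α(f,t)`. -/
def McoefAux (N : ℕ) (G : EuclideanSpace ℝ (Fin N) → ℝ → ℝ)
    (f : EuclideanSpace ℝ (Fin N) → ℝ) (t : ℝ) : ℕ → (Fin N → ℕ) → ℝ
  | 0, α => momE N α f
  | n + 1, α => momE N α f -
      ∑ β ∈ (Finset.Iic α).erase α,
        McoefAux N G f t n β * ∫ x, mpowE N α x * gA N G β x t

/-- `M_α(f,t)`, defined inductively on `|α|`:
`M_α(f,t) = ∫ x^α f dx - ∑_{β ≤ α, β ≠ α} M_β(f,t) ∫ x^α g_β(x,t) dx`. -/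
def Mcoef (N : ℕ) (G : EuclideanSpace ℝ (Fin N) → ℝ → ℝ)
    (f : EuclideanSpace ℝ (Fin N) → ℝ) (t : ℝ) (α : Fin N → ℕ) : ℝ :=
  McoefAux N G f t (∑ i, α i) α

/-- The finite set of multi-indices `α` with `|α| ≤ m`. -/
def multiIdx (N m : ℕ) : Finset (Fin N → ℕ) :=
  (Finset.Iic fun _ => m).filter fun α => ∑ i, α i ≤ m

/-- `P_K(t)f := f - ∑_{|α| ≤ K} M_α(f,t) g_α(·,t)`. -/
def PKop (N : ℕ) (G : EuclideanSpace ℝ (Fin N) → ℝ → ℝ) (K : ℝ) (t : ℝ)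
    (f : EuclideanSpace ℝ (Fin N) → ℝ) : EuclideanSpace ℝ (Fin N) → ℝ :=
  fun x => f x - ∑ α ∈ multiIdx N ⌊K⌋₊, Mcoef N G f t α * gA N G α x t

/-- The weighted `L¹` norm `|||φ|||_k = ∫ (1+|x|^k) ‖φ(x)‖ dx`, valued in `ℝ≥0∞`. -/
def wnorm (N : ℕ) {E' : Type*} [NormedAddCommGroup E'] (k : ℝ)
    (φ : EuclideanSpace ℝ (Fin N) → E') : ℝ≥0∞ :=
  ∫⁻ x, ENNReal.ofReal ((1 + ‖x‖ ^ k) * ‖φ x‖)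

/-- Membership in `L¹_k = L¹(ℝ^N, (1+|x|^k)dx)`. -/
def MemL1k (N : ℕ) (k : ℝ) (φ : EuclideanSpace ℝ (Fin N) → ℝ) : Prop :=
  AEStronglyMeasurable φ (volume : Measure (EuclideanSpace ℝ (Fin N))) ∧ wnorm N k φ < ⊤

/-- `E_{K,q}[f](t) = (1+t)^{K/d}[t^{(N/d)(1-1/q)} ‖f(t)‖_q + ‖f(t)‖_1] + |||f(t)|||_K`. -/
def Efun (N : ℕ) (d K : ℝ) (q : ℝ≥0∞) (f : EuclideanSpace ℝ (Fin N) → ℝ → ℝ) (t : ℝ) :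
    ℝ≥0∞ :=
  ENNReal.ofReal ((1 + t) ^ (K / d)) *
      (ENNReal.ofReal (t ^ (((N : ℝ) / d) * (1 - q.toReal⁻¹))) *
          eLpNorm (fun x => f x t) q volume +
        eLpNorm (fun x => f x t) 1 volume) +
    wnorm N K (fun x => f x t)

/-- `t^{(N/d)(1-1/q)} ‖w(t)‖_q + t^{-ℓ/d} |||w(t)|||_ℓ`. -/
def DistQ (N : ℕ) (d : ℝ) (q : ℝ≥0∞) (ℓ : ℝ) (w : EuclideanSpace ℝ (Fin N) → ℝ → ℝ)
    (t : ℝ) : ℝ≥0∞ :=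
  ENNReal.ofReal (t ^ (((N : ℝ) / d) * (1 - q.toReal⁻¹))) * eLpNorm (fun x => w x t) q volume +
    ENNReal.ofReal (t ^ (-ℓ / d)) * wnorm N ℓ (fun x => w x t)

end

/-- The remainder of the Taylor expansion of order `m` of `h ↦ K (x + h)`, evaluated at `-y`. -/
noncomputable def taylorRem {E : Type*} [NormedAddCommGroup E] [NormedSpace ℝ E] (K : E → ℝ) (m : ℕ)
    (x y : E) : ℝ :=
  K (x - y) - ∑ j ∈ Finset.range (m + 1),
    ((j.factorial : ℝ)⁻¹ * iteratedFDeriv ℝ j K x (fun _ => -y))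

lemma one_add_norm_le_mul {E : Type*} [SeminormedAddCommGroup E] (x y : E) : 1 + ‖x‖ ≤ (1 + ‖x - y‖) * (1 + ‖y‖) := by
  have h : ‖x‖ ≤ ‖x - y‖ + ‖y‖ := by simpa using norm_add_le (x - y) y
  nlinarith [norm_nonneg (x - y), norm_nonneg y]

lemma norm_rpow_mul_one_add_norm_rpow_le {E : Type*} [SeminormedAddCommGroup E] (x : E) {a r : ℝ}
    (ha : 0 ≤ a) :
    ‖x‖ ^ a * (1 + ‖x‖) ^ (-r) ≤ (1 + ‖x‖) ^ (a - r) := by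
  rw [sub_eq_add_neg, Real.rpow_add (by positivity)]
  gcongr
  linarith

section Remainder

variable {E : Type*} [NormedAddCommGroup E] [NormedSpace ℝ E] {K : E → ℝ} {m : ℕ}

lemma abs_taylorRem_le (hK : ContDiff ℝ (m + 1 : ℕ) K) (x y : E) {B : ℝ}
    (hB : ∀ s ∈ Set.Icc (0 : ℝ) 1, ‖iteratedFDeriv ℝ (m + 1) K (x - s • y)‖ ≤ B) :
    |taylorRem K m x y| ≤ B * ‖y‖ ^ (m + 1) := by
  have hT := map_add_eq_sum_add_integral_iteratedFDeriv (f := K) (x := x) (y := -y) (n := m)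
    (fun t _ => by exact_mod_cast hK.contDiffAt)
  have hR : taylorRem K m x y = (m.factorial : ℝ)⁻¹ •
      ∫ t in (0 : ℝ)..1, (1 - t) ^ m • iteratedFDeriv ℝ (m + 1) K (x + t • -y) (fun _ => -y) := by
    rw [taylorRem, sub_eq_add_neg x y, hT]
    simp only [smul_eq_mul]
    ring
  have hB0 : 0 ≤ B := (norm_nonneg _).trans (hB 0 (by simp))
  have hI : ‖∫ t in (0 : ℝ)..1,
      (1 - t) ^ m • iteratedFDeriv ℝ (m + 1) K (x + t • -y) (fun _ => -y)‖
        ≤ (B * ‖y‖ ^ (m + 1)) * |(1 : ℝ) - 0| := by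
    refine intervalIntegral.norm_integral_le_of_norm_le_const fun t ht => ?_
    rw [Set.uIoc_of_le zero_le_one] at ht
    have h1 : ‖iteratedFDeriv ℝ (m + 1) K (x + t • -y) (fun _ => -y)‖ ≤ B * ‖y‖ ^ (m + 1) := by
      refine (ContinuousMultilinearMap.le_opNorm _ _).trans ?_
      simp only [norm_neg, Finset.prod_const, Finset.card_univ, Fintype.card_fin]
      gcongr
      have := hB t ⟨ht.1.le, ht.2⟩
      rwa [sub_eq_add_neg, ← smul_neg] at this
    have h2 : ‖(1 - t) ^ m‖ ≤ 1 := by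
      rw [norm_pow]
      refine pow_le_one₀ (norm_nonneg _) ?_
      rw [Real.norm_eq_abs, abs_le]
      constructor <;> linarith [ht.1, ht.2]
    rw [norm_smul]
    calc _ ≤ 1 * (B * ‖y‖ ^ (m + 1)) := by gcongr
      _ = _ := one_mul _
  rw [hR, ← Real.norm_eq_abs, norm_smul]
  have h3 : ‖(m.factorial : ℝ)⁻¹‖ ≤ 1 := by
    rw [norm_inv, Real.norm_natCast]
    exact inv_le_one_of_one_le₀ (by exact_mod_cast Nat.one_le_iff_ne_zero.mpr m.factorial_ne_zero)
  calc _ ≤ 1 * ((B * ‖y‖ ^ (m + 1)) * |(1 : ℝ) - 0|) := by gcongr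
    _ = _ := by simp

/-- Weighted pointwise bound for the Taylor remainder of a kernel with decaying derivatives. -/
lemma exists_norm_rpow_mul_abs_taylorRem_le (hK : ContDiff ℝ (m + 1 : ℕ) K) {C r k ℓ : ℝ}
    (hC : 0 ≤ C) (hr : 0 ≤ r)
    (hdecay : ∀ j ≤ m + 1, ∀ x, ‖iteratedFDeriv ℝ j K x‖ ≤ C * (1 + ‖x‖) ^ (-r))
    (hℓ0 : 0 ≤ ℓ) (hℓk : ℓ ≤ k) (hmk : m ≤ k) (hkm : k ≤ m + 1) :
    ∃ A : ℝ, 0 < A ∧ ∀ x y : E, ‖x‖ ^ ℓ * |taylorRem K m x y| ≤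
      A * ‖y‖ ^ k * ((1 + ‖x‖) ^ (ℓ - r) + (1 + ‖x - y‖) ^ (ℓ - r)) := by
  have hk0 : 0 ≤ k := hℓ0.trans hℓk
  refine ⟨C * 2 ^ r + C * 2 ^ ℓ + C * (m + 1) + 1, by positivity, fun x y => ?_⟩
  have hvx : 0 ≤ (1 + ‖x‖) ^ (ℓ - r) := by positivity
  have hvy : 0 ≤ (1 + ‖x - y‖) ^ (ℓ - r) := by positivity
  have hyk : 0 ≤ ‖y‖ ^ k := by positivity
  have hx := norm_rpow_mul_one_add_norm_rpow_le x (r := r) hℓ0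
  rcases le_total ‖y‖ 1 with hy | hy
  · have hR : |taylorRem K m x y| ≤ (C * 2 ^ r * (1 + ‖x‖) ^ (-r)) * ‖y‖ ^ (m + 1) := by
      refine abs_taylorRem_le hK x y fun s hs => (hdecay _ le_rfl _).trans ?_
      rw [mul_assoc]
      gcongr
      have hsy : ‖s • y‖ ≤ 1 := by
        rw [norm_smul, Real.norm_of_nonneg hs.1]
        exact mul_le_one₀ hs.2 (norm_nonneg _) hy
      have h1 : 1 + ‖x‖ ≤ 2 * (1 + ‖x - s • y‖) := by
        have := one_add_norm_le_mul x (s • y)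
        nlinarith [norm_nonneg (x - s • y)]
      have h2 : (1 + ‖x‖) ^ r ≤ 2 ^ r * (1 + ‖x - s • y‖) ^ r := by
        rw [← Real.mul_rpow (by norm_num) (by positivity)]
        gcongr
      rw [Real.rpow_neg (by positivity), Real.rpow_neg (by positivity), ← div_eq_mul_inv,
        inv_eq_one_div, div_le_div_iff₀ (by positivity) (by positivity)]
      linarith
    have hpow : ‖y‖ ^ (m + 1) ≤ ‖y‖ ^ k := by
      rcases (norm_nonneg y).eq_or_lt with h0 | h0
      · rw [← h0, zero_pow (Nat.succ_ne_zero m)]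
        positivity
      · rw [← Real.rpow_natCast]
        exact Real.rpow_le_rpow_of_exponent_ge h0 hy (by exact_mod_cast hkm)
    calc ‖x‖ ^ ℓ * |taylorRem K m x y|
        ≤ ‖x‖ ^ ℓ * ((C * 2 ^ r * (1 + ‖x‖) ^ (-r)) * ‖y‖ ^ k) := by
          gcongr
          exact hR.trans (by gcongr)
      _ = C * 2 ^ r * ‖y‖ ^ k * (‖x‖ ^ ℓ * (1 + ‖x‖) ^ (-r)) := by ring
      _ ≤ C * 2 ^ r * ‖y‖ ^ k * (1 + ‖x‖) ^ (ℓ - r) := by gcongr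
      _ ≤ _ := by
          gcongr
          · have : 0 ≤ C * 2 ^ ℓ + C * (m + 1) + 1 := by positivity
            linarith
          · linarith
  · have hm : ∀ j ∈ Finset.range (m + 1),
        |(j.factorial : ℝ)⁻¹ * iteratedFDeriv ℝ j K x (fun _ => -y)| ≤
          C * (1 + ‖x‖) ^ (-r) * ‖y‖ ^ k := by
      intro j hj
      have hj' : j ≤ m := Nat.lt_succ_iff.mp (Finset.mem_range.mp hj)
      have h3 : |(j.factorial : ℝ)⁻¹| ≤ 1 := by
        rw [abs_of_nonneg (by positivity)]
        exact inv_le_one_of_one_le₀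
          (by exact_mod_cast Nat.one_le_iff_ne_zero.mpr j.factorial_ne_zero)
      have h4 : |iteratedFDeriv ℝ j K x (fun _ => -y)| ≤ C * (1 + ‖x‖) ^ (-r) * ‖y‖ ^ k := by
        refine ((iteratedFDeriv ℝ j K x).le_opNorm _).trans ?_
        simp only [norm_neg, Finset.prod_const, Finset.card_univ, Fintype.card_fin]
        gcongr
        · exact hdecay j (by omega) x
        · rw [← Real.rpow_natCast]
          exact Real.rpow_le_rpow_of_exponent_le hy (le_trans (by exact_mod_cast hj') hmk)
      rw [abs_mul]
      calc _ ≤ 1 * (C * (1 + ‖x‖) ^ (-r) * ‖y‖ ^ k) := by gcongr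
        _ = _ := one_mul _
    have h0 : |K (x - y)| ≤ C * (1 + ‖x - y‖) ^ (-r) := by
      simpa using hdecay 0 (Nat.zero_le _) (x - y)
    have hxy : ‖x‖ ^ ℓ ≤ (1 + ‖x - y‖) ^ ℓ * (2 ^ ℓ * ‖y‖ ^ k) := by
      calc ‖x‖ ^ ℓ ≤ ((1 + ‖x - y‖) * (2 * ‖y‖)) ^ ℓ := by
            gcongr
            have := one_add_norm_le_mul x y
            nlinarith [norm_nonneg (x - y)]
        _ = (1 + ‖x - y‖) ^ ℓ * (2 ^ ℓ * ‖y‖ ^ ℓ) := by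
            rw [Real.mul_rpow (by positivity) (by positivity),
              Real.mul_rpow (by positivity) (by positivity)]
        _ ≤ _ := by
            gcongr
    have hR : |taylorRem K m x y| ≤
        C * (1 + ‖x - y‖) ^ (-r) + (m + 1) * (C * (1 + ‖x‖) ^ (-r) * ‖y‖ ^ k) := by
      refine (abs_sub _ _).trans (add_le_add h0 ?_)
      refine (Finset.abs_sum_le_sum_abs _ _).trans ((Finset.sum_le_sum hm).trans ?_)
      simp
    calc ‖x‖ ^ ℓ * |taylorRem K m x y|
        ≤ ‖x‖ ^ ℓ * (C * (1 + ‖x - y‖) ^ (-r) +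
            (m + 1) * (C * (1 + ‖x‖) ^ (-r) * ‖y‖ ^ k)) := by gcongr
      _ = C * (1 + ‖x - y‖) ^ (-r) * ‖x‖ ^ ℓ +
            C * (m + 1) * ‖y‖ ^ k * (‖x‖ ^ ℓ * (1 + ‖x‖) ^ (-r)) := by ring
      _ ≤ C * (1 + ‖x - y‖) ^ (-r) * ((1 + ‖x - y‖) ^ ℓ * (2 ^ ℓ * ‖y‖ ^ k)) +
            C * (m + 1) * ‖y‖ ^ k * (1 + ‖x‖) ^ (ℓ - r) := by gcongr
      _ = C * 2 ^ ℓ * ‖y‖ ^ k * (1 + ‖x - y‖) ^ (ℓ - r) +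
            C * (m + 1) * ‖y‖ ^ k * (1 + ‖x‖) ^ (ℓ - r) := by
          rw [sub_eq_add_neg ℓ r, Real.rpow_add (by positivity : 0 < 1 + ‖x - y‖)]
          ring
      _ ≤ (C * 2 ^ r + C * 2 ^ ℓ + C * (m + 1) + 1) * ‖y‖ ^ k * (1 + ‖x - y‖) ^ (ℓ - r) +
            (C * 2 ^ r + C * 2 ^ ℓ + C * (m + 1) + 1) * ‖y‖ ^ k * (1 + ‖x‖) ^ (ℓ - r) := by
          have e1 : 0 ≤ C * 2 ^ r := by positivity
          have e2 : 0 ≤ C * 2 ^ ℓ := by positivity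
          have e3 : 0 ≤ C * ((m : ℝ) + 1) := by positivity
          gcongr <;> linarith
      _ = _ := by ring

end Remainder

section Moments

variable {N : ℕ}

lemma prod_coord_eq_mpowE {j : ℕ} (f : Fin j → Fin N) (y : EuclideanSpace ℝ (Fin N)) :
    ∏ i, y (f i) = mpowE N (fun a => (Finset.univ.filter fun i => f i = a).card) y := by
  rw [mpowE, ← Finset.prod_fiberwise' Finset.univ f (fun a => y a)]
  simp

lemma abs_prod_coord_le {j : ℕ} (f : Fin j → Fin N) (y : EuclideanSpace ℝ (Fin N)) :
    |∏ i, y (f i)| ≤ ‖y‖ ^ j := by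
  rw [Finset.abs_prod]
  refine (Finset.prod_le_prod (fun _ _ => abs_nonneg _)
    fun i _ => PiLp.norm_apply_le y (f i)).trans ?_
  simp

lemma multilinear_smul_const_eq_sum {j : ℕ}
    (A : ContinuousMultilinearMap ℝ (fun _ : Fin j => EuclideanSpace ℝ (Fin N)) ℝ) (c : ℝ)
    (y : EuclideanSpace ℝ (Fin N)) :
    A (fun _ => c • y) = ∑ f : Fin j → Fin N,
      (c ^ j * A fun i => EuclideanSpace.single (f i) 1) * ∏ i, y (f i) := by
  have hy : c • y = ∑ a, (c * y a) • EuclideanSpace.single a (1 : ℝ) := by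
    ext b
    simp [Finset.sum_apply, Pi.single_apply]
  rw [hy, A.map_sum]
  refine Finset.sum_congr rfl fun f _ => ?_
  rw [A.map_smul_univ, Finset.prod_mul_distrib]
  simp
  ring

variable {φ : EuclideanSpace ℝ (Fin N) → ℝ}

lemma integrable_prod_coord_mul {j : ℕ} (f : Fin j → Fin N)
    (hφ : AEStronglyMeasurable φ) (hj : Integrable fun y => ‖y‖ ^ j * |φ y|) :
    Integrable fun y => (∏ i, y (f i)) * φ y := by
  refine hj.mono' ((by fun_prop : Continuous fun y : EuclideanSpace ℝ (Fin N) =>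
    ∏ i, y (f i)).aestronglyMeasurable.mul hφ) (Eventually.of_forall fun y => ?_)
  rw [Real.norm_eq_abs, abs_mul]
  gcongr
  exact abs_prod_coord_le f y

lemma integrable_multilinear_mul {j : ℕ}
    (A : ContinuousMultilinearMap ℝ (fun _ : Fin j => EuclideanSpace ℝ (Fin N)) ℝ) (c : ℝ)
    (hφ : AEStronglyMeasurable φ) (hj : Integrable fun y => ‖y‖ ^ j * |φ y|) :
    Integrable fun y => A (fun _ => c • y) * φ y := by
  simp only [multilinear_smul_const_eq_sum, Finset.sum_mul, mul_assoc]
  exact integrable_finsetSum _ fun f _ =>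
    ((integrable_prod_coord_mul f hφ hj).const_mul _).const_mul _

lemma integral_multilinear_mul_eq_zero {j : ℕ}
    (A : ContinuousMultilinearMap ℝ (fun _ : Fin j => EuclideanSpace ℝ (Fin N)) ℝ) (c : ℝ)
    (hφ : AEStronglyMeasurable φ) (hj : Integrable fun y => ‖y‖ ^ j * |φ y|)
    (hmom : ∀ α : Fin N → ℕ, ∑ i, α i = j → ∫ x, mpowE N α x * φ x = 0) :
    ∫ y, A (fun _ => c • y) * φ y = 0 := by
  simp only [multilinear_smul_const_eq_sum, Finset.sum_mul, mul_assoc]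
  rw [integral_finsetSum _ fun f _ =>
    ((integrable_prod_coord_mul f hφ hj).const_mul _).const_mul _]
  refine Finset.sum_eq_zero fun f _ => ?_
  rw [integral_const_mul, integral_const_mul]
  simp only [prod_coord_eq_mpowE]
  rw [hmom _ ?_, mul_zero, mul_zero]
  rw [← Finset.card_eq_sum_card_fiberwise (fun _ _ => Finset.mem_coe.mpr (Finset.mem_univ _))]
  simp

/-- Vanishing moments allow subtracting the Taylor polynomial inside a convolution. -/
lemma integral_comp_smul_sub_mul_eq_taylorRem {K : EuclideanSpace ℝ (Fin N) → ℝ} {m : ℕ} {C : ℝ}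
    (hK : Continuous K) (hKC : ∀ x, |K x| ≤ C) (hφ : AEStronglyMeasurable φ)
    (hint : ∀ j ≤ m, Integrable fun y => ‖y‖ ^ j * |φ y|)
    (hmom : ∀ α : Fin N → ℕ, ∑ i, α i ≤ m → ∫ x, mpowE N α x * φ x = 0)
    (c : ℝ) (x : EuclideanSpace ℝ (Fin N)) :
    ∫ y, K (c • (x - y)) * φ y = ∫ y, taylorRem K m (c • x) (c • y) * φ y := by
  have hφi : Integrable φ := by
    refine (integrable_norm_iff hφ).mp ?_
    simpa using hint 0 (Nat.zero_le _)
  have h1 : Integrable fun y => K (c • (x - y)) * φ y :=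
    hφi.bdd_mul (c := C)
      (by fun_prop : Continuous fun y => K (c • (x - y))).aestronglyMeasurable
      (Eventually.of_forall fun y => hKC _)
  have hle : ∀ j ∈ Finset.range (m + 1), j ≤ m := fun j hj =>
    Nat.lt_succ_iff.mp (Finset.mem_range.mp hj)
  have h2 : ∀ j ∈ Finset.range (m + 1), Integrable fun y =>
      (j.factorial : ℝ)⁻¹ * (iteratedFDeriv ℝ j K (c • x) (fun _ => (-c) • y) * φ y) := fun j hj =>
    (integrable_multilinear_mul _ _ hφ (hint j (hle j hj))).const_mul _
  have h3 : ∀ y, taylorRem K m (c • x) (c • y) * φ y = K (c • (x - y)) * φ y -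
      ∑ j ∈ Finset.range (m + 1),
        (j.factorial : ℝ)⁻¹ * (iteratedFDeriv ℝ j K (c • x) (fun _ => (-c) • y) * φ y) := by
    intro y
    simp only [taylorRem, sub_mul, Finset.sum_mul, smul_sub, neg_smul, mul_assoc]
  simp only [h3]
  rw [integral_sub h1 (integrable_finsetSum _ h2), integral_finsetSum _ h2,
    Finset.sum_eq_zero, sub_zero]
  intro j hj
  rw [integral_const_mul, integral_multilinear_mul_eq_zero _ _ hφ (hint j (hle j hj)), mul_zero]
  exact fun α hα => hmom α (hα.trans_le (hle j hj))

end Moments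

section Main

variable {N : ℕ}

lemma lintegral_one_add_norm_smul {c : ℝ} (hc : 0 < c) (q : ℝ) :
    ENNReal.ofReal (c ^ N) *
        ∫⁻ x : EuclideanSpace ℝ (Fin N), ENNReal.ofReal ((1 + ‖c • x‖) ^ (-q)) =
      ∫⁻ x : EuclideanSpace ℝ (Fin N), ENNReal.ofReal ((1 + ‖x‖) ^ (-q)) := by
  have hm : Measurable fun x : EuclideanSpace ℝ (Fin N) =>
      ENNReal.ofReal ((1 + ‖x‖) ^ (-q)) := by fun_prop
  rw [← lintegral_map hm (measurable_const_smul c),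
    Measure.map_addHaar_smul volume hc.ne', lintegral_smul_measure, smul_eq_mul, ← mul_assoc,
    ← ENNReal.ofReal_mul (by positivity)]
  simp [abs_of_pos hc, hc.ne']

/-- Fubini estimate for an integral operator whose kernel has a weighted convolution bound. -/
lemma lintegral_norm_rpow_mul_abs_integral_le {R : EuclideanSpace ℝ (Fin N) →
    EuclideanSpace ℝ (Fin N) → ℝ} {A q k ℓ c : ℝ} (hc : 0 < c) (hA : 0 ≤ A) (hq : (N : ℝ) < q)
    (hR : ∀ x y, ‖x‖ ^ ℓ * |R x y| ≤
      A * ‖y‖ ^ k * ((1 + ‖x‖) ^ (-q) + (1 + ‖x - y‖) ^ (-q)))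
    {φ : EuclideanSpace ℝ (Fin N) → ℝ}
    (hk : Integrable fun y => ‖y‖ ^ k * |φ y|) :
    (∫⁻ x, ENNReal.ofReal (‖x‖ ^ ℓ * |c ^ N * ∫ y, R (c • x) (c • y) * φ y|)) ≤
      ENNReal.ofReal (2 * A * (∫ x : EuclideanSpace ℝ (Fin N), (1 + ‖x‖) ^ (-q)) *
        c ^ (k - ℓ) * ∫ y, ‖y‖ ^ k * |φ y|) := by
  set J := ∫⁻ x : EuclideanSpace ℝ (Fin N), ENNReal.ofReal ((1 + ‖x‖) ^ (-q))
  have hJ : 2 * J = ENNReal.ofReal (2 * ∫ x : EuclideanSpace ℝ (Fin N), (1 + ‖x‖) ^ (-q)) := by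
    rw [ENNReal.ofReal_mul zero_le_two, ENNReal.ofReal_ofNat,
      ofReal_integral_eq_lintegral_ofReal (integrable_one_add_norm (by simpa using hq))
      (Eventually.of_forall fun x => by positivity)]
  set w : EuclideanSpace ℝ (Fin N) → ℝ≥0∞ := fun x => ENNReal.ofReal ((1 + ‖c • x‖) ^ (-q))
    with hw
  have hwm : Measurable w := by fun_prop
  set u : EuclideanSpace ℝ (Fin N) → ℝ≥0∞ := fun y => ENNReal.ofReal (‖y‖ ^ k * |φ y|) with hu
  have hum : AEMeasurable u := hk.aestronglyMeasurable.aemeasurable.ennreal_ofReal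
  set D : ℝ := A * c ^ (k - ℓ) with hD
  have hD0 : 0 ≤ D := by positivity
  have hpt : ∀ x y : EuclideanSpace ℝ (Fin N), ‖x‖ ^ ℓ * (c ^ N * |R (c • x) (c • y) * φ y|) ≤
      c ^ N * (D * ((‖y‖ ^ k * |φ y|) *
        ((1 + ‖c • x‖) ^ (-q) + (1 + ‖c • (x - y)‖) ^ (-q)))) := by
    intro x y
    have h := hR (c • x) (c • y)
    rw [← smul_sub, norm_smul c x, norm_smul c y, Real.norm_of_nonneg hc.le,
      Real.mul_rpow hc.le (norm_nonneg _), Real.mul_rpow hc.le (norm_nonneg _)] at h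
    rw [norm_smul c x, Real.norm_of_nonneg hc.le]
    have hcl : 0 < c ^ ℓ := Real.rpow_pos_of_pos hc _
    have h' : ‖x‖ ^ ℓ * |R (c • x) (c • y)| ≤ D * ‖y‖ ^ k *
        ((1 + c * ‖x‖) ^ (-q) + (1 + ‖c • (x - y)‖) ^ (-q)) := by
      rw [hD, Real.rpow_sub hc, ← mul_le_mul_iff_right₀ hcl]
      refine (le_of_eq (by ring)).trans (h.trans (le_of_eq ?_))
      field_simp
    calc _ = c ^ N * |φ y| * (‖x‖ ^ ℓ * |R (c • x) (c • y)|) := by rw [abs_mul]; ring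
      _ ≤ c ^ N * |φ y| * (D * ‖y‖ ^ k *
        ((1 + c * ‖x‖) ^ (-q) + (1 + ‖c • (x - y)‖) ^ (-q))) := by gcongr
      _ = _ := by ring
  have hstep : ∀ x, ENNReal.ofReal (‖x‖ ^ ℓ * |c ^ N * ∫ y, R (c • x) (c • y) * φ y|) ≤
      ∫⁻ y, ENNReal.ofReal (c ^ N) * (ENNReal.ofReal D * (u y * (w x + w (x - y)))) := by
    intro x
    have e : ‖x‖ ^ ℓ * |c ^ N * ∫ y, R (c • x) (c • y) * φ y| =
        ‖∫ y, ‖x‖ ^ ℓ * (c ^ N * (R (c • x) (c • y) * φ y))‖ := by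
      rw [integral_const_mul, integral_const_mul, norm_mul, Real.norm_eq_abs, Real.norm_eq_abs,
        abs_of_nonneg (by positivity : 0 ≤ ‖x‖ ^ ℓ)]
    rw [e, ofReal_norm]
    refine (enorm_integral_le_lintegral_enorm _).trans (lintegral_mono fun y => ?_)
    rw [← ofReal_norm]
    simp only [hu, hw]
    rw [← ENNReal.ofReal_add (by positivity) (by positivity),
      ← ENNReal.ofReal_mul (by positivity), ← ENNReal.ofReal_mul hD0,
      ← ENNReal.ofReal_mul (by positivity)]
    refine ENNReal.ofReal_le_ofReal (le_trans (le_of_eq ?_) (hpt x y))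
    rw [norm_mul, norm_mul, Real.norm_of_nonneg (by positivity : 0 ≤ ‖x‖ ^ ℓ),
      Real.norm_of_nonneg (by positivity : 0 ≤ c ^ N), Real.norm_eq_abs]
  have hw2 : ∀ y, ENNReal.ofReal (c ^ N) * ∫⁻ x, (w x + w (x - y)) = 2 * J := by
    intro y
    rw [lintegral_add_left hwm, lintegral_sub_right_eq_self w y, ← two_mul, mul_left_comm,
      lintegral_one_add_norm_smul hc]
  calc _ ≤ ∫⁻ x, ∫⁻ y, ENNReal.ofReal (c ^ N) *
        (ENNReal.ofReal D * (u y * (w x + w (x - y)))) := lintegral_mono hstep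
    _ = ∫⁻ y, ∫⁻ x, ENNReal.ofReal (c ^ N) *
        (ENNReal.ofReal D * (u y * (w x + w (x - y)))) := by
      refine lintegral_lintegral_swap ?_
      have h1 : AEMeasurable (fun p : EuclideanSpace ℝ (Fin N) × EuclideanSpace ℝ (Fin N) =>
          u p.2) (volume.prod volume) := hum.comp_snd
      have h2 : Measurable (fun p : EuclideanSpace ℝ (Fin N) × EuclideanSpace ℝ (Fin N) =>
          w p.1 + w (p.1 - p.2)) :=
        (hwm.comp measurable_fst).add (hwm.comp (measurable_fst.sub measurable_snd))
      exact ((h1.mul h2.aemeasurable).const_mul _).const_mul _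
    _ = ∫⁻ y, (ENNReal.ofReal D * (2 * J)) * u y := by
      refine lintegral_congr fun y => ?_
      have hm : Measurable fun x => w x + w (x - y) :=
        hwm.add (hwm.comp (measurable_id.sub_const y))
      rw [lintegral_const_mul _ ((hm.const_mul _).const_mul _),
        lintegral_const_mul _ (hm.const_mul _), lintegral_const_mul _ hm, ← hw2 y]
      ring
    _ = _ := by
      rw [lintegral_const_mul'' _ hum, hu, ← ofReal_integral_eq_lintegral_ofReal hk
        (Eventually.of_forall fun y => by positivity), hJ,
        ← ENNReal.ofReal_mul hD0,
        ← ENNReal.ofReal_mul (by positivity), hD]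
      congr 1
      ring

lemma MemL1k.integrable_norm_rpow_mul {k j : ℝ} {φ : EuclideanSpace ℝ (Fin N) → ℝ}
    (h : MemL1k N k φ) (hj0 : 0 ≤ j) (hjk : j ≤ k) : Integrable fun y => ‖y‖ ^ j * |φ y| := by
  have hm : ∀ a : ℝ, AEStronglyMeasurable fun y : EuclideanSpace ℝ (Fin N) => ‖y‖ ^ a * |φ y| :=
    fun a => ((by fun_prop : Measurable fun y : EuclideanSpace ℝ (Fin N) =>
      ‖y‖ ^ a).aestronglyMeasurable).mul h.1.norm
  have h1 : Integrable fun y => (1 + ‖y‖ ^ k) * ‖φ y‖ := by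
    refine ⟨?_, ?_⟩
    · exact ((by fun_prop : Measurable fun y : EuclideanSpace ℝ (Fin N) =>
        1 + ‖y‖ ^ k).aestronglyMeasurable).mul h.1.norm
    · rw [hasFiniteIntegral_iff_ofReal (Eventually.of_forall fun y => by positivity)]
      exact h.2
  refine h1.mono' (hm j) (Eventually.of_forall fun y => ?_)
  rw [Real.norm_of_nonneg (by positivity), Real.norm_eq_abs]
  gcongr
  rcases le_total ‖y‖ 1 with hy | hy
  · have h2 := Real.rpow_le_one (norm_nonneg y) hy hj0
    have h3 : 0 ≤ ‖y‖ ^ k := by positivity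
    linarith
  · have := Real.rpow_le_rpow_of_exponent_le hy hjk
    linarith

section Kernel

variable {γ : ℕ} {d L : ℝ} {G : EuclideanSpace ℝ (Fin N) → ℝ → ℝ}

lemma CondG.contDiff_one (hG : CondG N G γ d L) : ContDiff ℝ γ fun x => G x 1 := by
  have h : ContDiff ℝ γ fun x : EuclideanSpace ℝ (Fin N) => (x, (1 : ℝ)) := by fun_prop
  exact contDiffOn_univ.mp
    (hG.smooth.comp h.contDiffOn fun x _ => (zero_lt_one : (0 : ℝ) < 1))

lemma CondG.exists_norm_iteratedFDeriv_le (hG : CondG N G γ d L) :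
    ∃ C : ℝ, 0 ≤ C ∧ ∀ j ≤ γ, ∀ x, ‖iteratedFDeriv ℝ j (fun y => G y 1) x‖ ≤
      C * (1 + ‖x‖) ^ (-((N : ℝ) + L)) := by
  choose! C hC using hG.decay
  refine ⟨∑ j ∈ Finset.range (γ + 1), |C j|, Finset.sum_nonneg fun _ _ => abs_nonneg _,
    fun j hj x => ?_⟩
  have h1 : (1 + ‖x‖) ^ ((N : ℝ) + L) * ‖iteratedFDeriv ℝ j (fun y => G y 1) x‖ ≤
      ∑ j ∈ Finset.range (γ + 1), |C j| := by
    calc _ ≤ (1 + ‖x‖) ^ ((N : ℝ) + L + j) * ‖iteratedFDeriv ℝ j (fun y => G y 1) x‖ := by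
          refine mul_le_mul_of_nonneg_right ?_ (norm_nonneg _)
          exact Real.rpow_le_rpow_of_exponent_le (by simp) (by simp)
      _ ≤ |C j| := (hC j hj x).trans (le_abs_self _)
      _ ≤ _ := Finset.single_le_sum (f := fun j => |C j|) (fun _ _ => abs_nonneg _)
          (Finset.mem_range.mpr (Nat.lt_succ_iff.mpr hj))
  rw [Real.rpow_neg (by positivity), ← div_eq_mul_inv, le_div_iff₀ (by positivity)]
  linarith

lemma CondG.apply_eq (hG : CondG N G γ d L) (x : EuclideanSpace ℝ (Fin N)) {t : ℝ}
    (ht : 0 < t) : G x t = (t ^ (-(1 : ℝ) / d)) ^ N * G ((t ^ (-(1 : ℝ) / d)) • x) 1 := by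
  rw [hG.scaling x t ht, ← Real.rpow_mul_natCast ht.le]
  congr 2
  ring

end Kernel

end Main

/-- Proposition 3.1 (ii): for `ℓ ∈ [0,k]` there is `C₂` such that for every
`φ ∈ L¹_k` with vanishing moments up to order `k`,
`∫ |x|^ℓ |e^{tℒ}φ(x)| dx ≤ C₂ t^{-(k-ℓ)/d} ∫ |x|^k |φ(x)| dx` for all `t > 0`. -/
theorem stmt14 (N γ : ℕ) (hN : 1 ≤ N) (d L : ℝ) (hd : 0 < d) (hL : 0 < L)
    (G : EuclideanSpace ℝ (Fin N) → ℝ → ℝ) (hG : CondG N G γ d L)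
    (k : ℝ) (hk0 : 0 ≤ k) (hkL : k < L) (hkγ : ⌈k⌉₊ + 1 ≤ γ)
    (ℓ : ℝ) (hℓ : ℓ ∈ Set.Icc 0 k) :
    ∃ C₂ : ℝ, 0 < C₂ ∧
      ∀ φ : EuclideanSpace ℝ (Fin N) → ℝ, MemL1k N k φ →
        (∀ α : Fin N → ℕ, (∑ i, α i) ≤ ⌊k⌋₊ → ∫ x, mpowE N α x * φ x = 0) →
        ∀ t : ℝ, 0 < t →
          (∫⁻ x, ENNReal.ofReal (‖x‖ ^ ℓ * |sgOp N G t φ x|)) ≤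
            ENNReal.ofReal (C₂ * t ^ (-(k - ℓ) / d) * ∫ x, ‖x‖ ^ k * |φ x|) := by
  obtain ⟨C, hC0, hC⟩ := hG.exists_norm_iteratedFDeriv_le
  have hmγ : ⌊k⌋₊ + 1 ≤ γ := (Nat.add_le_add_right (Nat.floor_le_ceil k) 1).trans hkγ
  have hK := hG.contDiff_one
  obtain ⟨A, hA, hR⟩ := exists_norm_rpow_mul_abs_taylorRem_le (m := ⌊k⌋₊) (k := k) (ℓ := ℓ)
    (hK.of_le (by exact_mod_cast hmγ)) hC0 (by positivity : 0 ≤ (N : ℝ) + L)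
    (fun j hj => hC j (hj.trans hmγ)) hℓ.1 hℓ.2 (Nat.floor_le hk0) (Nat.lt_floor_add_one k).le
  rw [← neg_sub] at hR
  have hKb : ∀ x, |G x 1| ≤ C := fun x => by
    have h := hC 0 (Nat.zero_le _) x
    rw [norm_iteratedFDeriv_zero, Real.norm_eq_abs] at h
    refine h.trans (mul_le_of_le_one_right hC0 ?_)
    exact Real.rpow_le_one_of_one_le_of_nonpos (by simp) (by linarith [N.cast_nonneg (α := ℝ)])
  have hJ : 0 ≤ ∫ x : EuclideanSpace ℝ (Fin N), (1 + ‖x‖) ^ (-((N : ℝ) + L - ℓ)) :=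
    integral_nonneg fun x => by positivity
  refine ⟨2 * A * (∫ x : EuclideanSpace ℝ (Fin N), (1 + ‖x‖) ^ (-((N : ℝ) + L - ℓ))) + 1,
    by positivity, fun φ hφ hmom t ht => ?_⟩
  have hc : 0 < t ^ (-(1 : ℝ) / d) := Real.rpow_pos_of_pos ht _
  have hsg : ∀ x, sgOp N G t φ x = (t ^ (-(1 : ℝ) / d)) ^ N *
      ∫ y, taylorRem (fun y => G y 1) ⌊k⌋₊ (t ^ (-(1 : ℝ) / d) • x)
        (t ^ (-(1 : ℝ) / d) • y) * φ y := by
    intro x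
    rw [← integral_comp_smul_sub_mul_eq_taylorRem hK.continuous hKb hφ.1 _ hmom,
      ← integral_const_mul]
    · refine integral_congr_ae (Eventually.of_forall fun y => ?_)
      simp only [hG.apply_eq _ ht, mul_assoc]
    · intro j hj
      have := hφ.integrable_norm_rpow_mul (j := j) (by positivity)
        ((Nat.cast_le.mpr hj).trans (Nat.floor_le hk0))
      simpa only [Real.rpow_natCast] using this
  have hexp : (t ^ (-(1 : ℝ) / d)) ^ (k - ℓ) = t ^ (-(k - ℓ) / d) := by
    rw [← Real.rpow_mul ht.le]
    congr 1
    ring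
  simp only [hsg]
  refine (lintegral_norm_rpow_mul_abs_integral_le hc hA.le (by linarith [hℓ.2]) hR
    (hφ.integrable_norm_rpow_mul hk0 le_rfl)).trans (ENNReal.ofReal_le_ofReal ?_)
  rw [hexp]
  have : 0 ≤ ∫ x, ‖x‖ ^ k * |φ x| := integral_nonneg fun x => by positivity
  gcongr
  linarith
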